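/- arXiv:2006.14498 — 3 statements merged into one kernel-verified Lean document; each statement's English description precedes it below -/
import Mathlib

section
/- Chen's identity (the multiplicative structure used to concatenate generated path segments): let X : [0,T] → ℝ^d be continuously differentiable and let 0 ≤ s ≤ T. Then for every n ≥ 1 and every multi-index (i₁,…,i_n) ∈ {1,…,d}^n one has S^{i₁…i_n}_{[0,T]}(X) = ∑_{k=0}^{n} S^{i₁…i_k}_{[0,s]}(X) · S^{i_{k+1}…i_n}_{[s,T]}(X), where the terms with empty multi-index equal 1. -/
open MeasureTheory intervalIntegral

/-- The level-`n` iterated integral (signature coordinate) of a path with coordinate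
derivatives `X' : ℝ → Fin d → ℝ`, indexed by a multi-index given as a list `l` of
coordinates, over the interval `[s, t]`; `1` for the empty multi-index. -/
noncomputable def sig {d : ℕ} (X' : ℝ → Fin d → ℝ) : List (Fin d) → ℝ → ℝ → ℝ
  | [], _, _ => 1
  | i :: is, s, t => ∫ u in s..t, X' u i * sig X' is u t

theorem continuousOn_sig {d : ℕ} {X' : ℝ → Fin d → ℝ} {a b : ℝ}
    (hcont : ContinuousOn X' (Set.uIcc a b)) {t : ℝ} (ht : t ∈ Set.uIcc a b)
    (l : List (Fin d)) : ContinuousOn (fun u => sig X' l u t) (Set.uIcc a b) := by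
  induction l with
  | nil => exact continuousOn_const
  | cons i l ih =>
    have hint : IntervalIntegrable (fun u => X' u i * sig X' l u t) volume a b :=
      ((continuousOn_pi.mp hcont i).mul ih).intervalIntegrable
    refine (continuousOn_primitive_interval' hint ht).neg.congr fun u _ => ?_
    simp only [sig, integral_symm t u, Pi.neg_apply]

theorem intervalIntegrable_mul_sig {d : ℕ} {X' : ℝ → Fin d → ℝ} {a b : ℝ}
    (hcont : ContinuousOn X' (Set.uIcc a b)) {t : ℝ} (ht : t ∈ Set.uIcc a b)
    (i : Fin d) (l : List (Fin d)) {r s : ℝ} (hr : r ∈ Set.uIcc a b) (hs : s ∈ Set.uIcc a b) :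
    IntervalIntegrable (fun u => X' u i * sig X' l u t) volume r s :=
  (((continuousOn_pi.mp hcont i).mul (continuousOn_sig hcont ht l)).mono
    (Set.uIcc_subset_uIcc hr hs)).intervalIntegrable

/-- Chen's identity for three arbitrary times in an interval on which the derivative of the
path is continuous. -/
theorem sig_eq_sum_take_mul_drop {d : ℕ} {X' : ℝ → Fin d → ℝ} {a b : ℝ}
    (hcont : ContinuousOn X' (Set.uIcc a b)) {r s t : ℝ} (hr : r ∈ Set.uIcc a b)
    (hs : s ∈ Set.uIcc a b) (ht : t ∈ Set.uIcc a b) (l : List (Fin d)) :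
    sig X' l r t =
      ∑ k ∈ Finset.range (l.length + 1), sig X' (l.take k) r s * sig X' (l.drop k) s t := by
  induction l generalizing r with
  | nil => simp [sig]
  | cons i l ih =>
    have hsplit : ∫ u in r..s, X' u i * sig X' l u t =
        ∑ k ∈ Finset.range (l.length + 1),
          (∫ u in r..s, X' u i * sig X' (l.take k) u s) * sig X' (l.drop k) s t := by
      simp_rw [← intervalIntegral.integral_mul_const]
      rw [← intervalIntegral.integral_finsetSum fun k _ =>
        (intervalIntegrable_mul_sig hcont hs i (l.take k) hr hs).mul_const _]
      refine integral_congr fun u hu => ?_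
      simp only [ih (Set.uIcc_subset_uIcc hr hs hu), Finset.mul_sum, mul_assoc]
    rw [List.length_cons, Finset.sum_range_succ']
    simp only [List.take_succ_cons, List.drop_succ_cons, List.take_zero, List.drop_zero, sig,
      one_mul]
    rw [← hsplit, integral_add_adjacent_intervals
      (intervalIntegrable_mul_sig hcont ht i l hr hs)
      (intervalIntegrable_mul_sig hcont ht i l hs ht)]

/-- **Chen's identity.** For a continuously differentiable path `X : [0,T] → ℝ^d` with
derivative `X'`, any intermediate time `0 ≤ s ≤ T`, every `n ≥ 1` and every multi-index
`(i₁,…,i_n)` one has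
`S^{i₁…i_n}_{[0,T]}(X) = ∑_{k=0}^{n} S^{i₁…i_k}_{[0,s]}(X) · S^{i_{k+1}…i_n}_{[s,T]}(X)`,
the terms with empty multi-index being `1`. -/
theorem signature_chen_identity {d : ℕ} (hd : 1 ≤ d) {T : ℝ} (hT : 0 < T)
    (X X' : ℝ → Fin d → ℝ)
    (hderiv : ∀ t ∈ Set.Icc (0 : ℝ) T, HasDerivWithinAt X (X' t) (Set.Icc 0 T) t)
    (hcont : ContinuousOn X' (Set.Icc 0 T))
    {s : ℝ} (hs0 : 0 ≤ s) (hsT : s ≤ T)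
    (l : List (Fin d)) (hl : 1 ≤ l.length) :
    sig X' l 0 T =
      ∑ k ∈ Finset.range (l.length + 1),
        sig X' (l.take k) 0 s * sig X' (l.drop k) s T := by
  have hu : Set.uIcc 0 T = Set.Icc 0 T := Set.uIcc_of_le hT.le
  rw [← hu] at hcont
  exact sig_eq_sum_take_mul_drop hcont Set.left_mem_uIcc (hu ▸ ⟨hs0, hsT⟩)
    Set.right_mem_uIcc l
end

section
/- The lead-lag transformation captures realized quadratic variation through its Lévy area: let N ≥ 1 and x₀, x₁, …, x_N ∈ ℝ, and let Z = (Z¹, Z²) : [0, 2N] → ℝ² be the continuous piecewise-linear lead-lag path determined by Z(2k) = (x_k, x_k) for 0 ≤ k ≤ N and Z(2k+1) = (x_k, x_{k+1}) for 0 ≤ k ≤ N−1, Z being affine on each interval [m, m+1] for integers 0 ≤ m < 2N. Then ∫₀^{2N} (Z²(u) − x₀)·(Z¹)'(u) du − ∫₀^{2N} (Z¹(u) − x₀)·(Z²)'(u) du = ∑_{k=0}^{N−1} (x_{k+1} − x_k)², where the derivatives (Zⁱ)' are the a.e.-defined piecewise-constant derivatives of the piecewise-linear path. -/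
open MeasureTheory intervalIntegral

/-- On an interval `[a, a + 1]` where `f` and `g` are affine and `D` is the derivative of `g`,
the integral of `(f - c) * D` is the mean of `f - c` times the increment of `g`. -/
theorem intervalIntegrable_and_integral_sub_mul_deriv_of_affine
    {f g D : ℝ → ℝ} {a : ℝ} (c : ℝ)
    (hf : ∀ t ∈ Set.Icc a (a + 1), f t = f a + (t - a) * (f (a + 1) - f a))
    (hg : ∀ t ∈ Set.Icc a (a + 1), g t = g a + (t - a) * (g (a + 1) - g a))
    (hD : ∀ t ∈ Set.Ioo a (a + 1), HasDerivAt g (D t) t) :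
    IntervalIntegrable (fun u => (f u - c) * D u) volume a (a + 1) ∧
      ∫ u in a..(a + 1), (f u - c) * D u =
        ((f a + f (a + 1)) / 2 - c) * (g (a + 1) - g a) := by
  have hle : a ≤ a + 1 := by linarith
  have hD' : ∀ t ∈ Set.Ioo a (a + 1), D t = g (a + 1) - g a := by
    intro t ht
    have haffine : HasDerivAt (fun s => g a + (s - a) * (g (a + 1) - g a))
        (g (a + 1) - g a) t := by
      simpa using (((hasDerivAt_id t).sub_const a).mul_const (g (a + 1) - g a)).const_add (g a)
    refine (hD t ht).unique (haffine.congr_of_eventuallyEq ?_)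
    filter_upwards [Icc_mem_nhds ht.1 ht.2] with s hs using hg s hs
  have heq : Set.EqOn
      (fun u => (f a + (u - a) * (f (a + 1) - f a) - c) * (g (a + 1) - g a))
      (fun u => (f u - c) * D u) (Set.uIoo a (a + 1)) := by
    intro u hu
    rw [Set.uIoo_of_le hle] at hu
    simp only [hD' u hu, hf u (Set.Ioo_subset_Icc_self hu)]
  refine ⟨(Continuous.intervalIntegrable (by fun_prop) _ _).congr_uIoo heq, ?_⟩
  rw [← integral_congr_uIoo heq]
  have hderiv : ∀ u ∈ Set.uIcc a (a + 1), HasDerivAt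
      (fun u => ((f a - c) * (u - a) + (u - a) ^ 2 / 2 * (f (a + 1) - f a)) * (g (a + 1) - g a))
      ((f a + (u - a) * (f (a + 1) - f a) - c) * (g (a + 1) - g a)) u := by
    intro u _
    have h : HasDerivAt (fun s => s - a) 1 u := (hasDerivAt_id u).sub_const a
    refine (((h.const_mul (f a - c)).fun_add
      (((h.fun_pow 2).div_const 2).mul_const (f (a + 1) - f a))).mul_const
        (g (a + 1) - g a)).congr_deriv ?_
    push_cast
    ring
  rw [integral_eq_sub_of_hasDerivAt hderiv (Continuous.intervalIntegrable (by fun_prop) _ _)]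
  ring

/-- The integral against the derivative of a piecewise affine function of a piecewise affine
function, with nodes at the natural numbers, is given by the trapezoidal rule. -/
theorem integral_sub_mul_deriv_eq_sum_of_piecewise_affine
    {f g D : ℝ → ℝ} (n : ℕ) (c : ℝ)
    (hf : ∀ m : ℕ, m < n → ∀ t ∈ Set.Icc (m : ℝ) ((m : ℝ) + 1),
      f t = f m + (t - m) * (f (m + 1) - f m))
    (hg : ∀ m : ℕ, m < n → ∀ t ∈ Set.Icc (m : ℝ) ((m : ℝ) + 1),
      g t = g m + (t - m) * (g (m + 1) - g m))
    (hD : ∀ m : ℕ, m < n → ∀ t ∈ Set.Ioo (m : ℝ) ((m : ℝ) + 1), HasDerivAt g (D t) t) :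
    ∫ u in (0 : ℝ)..n, (f u - c) * D u =
      ∑ m ∈ Finset.range n,
        ((f m + f (m + 1)) / 2 - c) * (g (m + 1) - g m) := by
  have hpiece := fun (m : ℕ) (hm : m < n) =>
    intervalIntegrable_and_integral_sub_mul_deriv_of_affine c (hf m hm) (hg m hm) (hD m hm)
  have hsum := sum_integral_adjacent_intervals (μ := volume) (f := fun u => (f u - c) * D u)
    (a := fun m : ℕ => (m : ℝ)) (n := n)
    (fun m hm => by simpa only [Nat.cast_add_one] using (hpiece m hm).1)
  rw [Nat.cast_zero] at hsum
  rw [← hsum]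
  refine Finset.sum_congr rfl fun m hm => ?_
  simpa only [Nat.cast_add_one] using (hpiece m (Finset.mem_range.mp hm)).2

theorem sum_range_two_mul_eq_sum_add {M : Type*} [AddCommMonoid M] (f : ℕ → M) (n : ℕ) :
    ∑ m ∈ Finset.range (2 * n), f m =
      ∑ k ∈ Finset.range n, (f (2 * k) + f (2 * k + 1)) := by
  induction n with
  | zero => simp
  | succ n ih =>
    rw [Finset.sum_range_succ, ← ih, Nat.mul_succ, Finset.sum_range_succ, Finset.sum_range_succ,
      add_assoc]

/-- **The lead-lag transformation captures realized quadratic variation through its Lévy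
area.**  Let `x₀, …, x_N ∈ ℝ` and let `Z = (Z¹, Z²) : [0, 2N] → ℝ²` be the continuous
piecewise-linear lead-lag path with `Z(2k) = (x_k, x_k)` for `0 ≤ k ≤ N`,
`Z(2k+1) = (x_k, x_{k+1})` for `0 ≤ k ≤ N−1`, and `Z` affine on each `[m, m+1]`.
With `D¹, D²` the (a.e.-defined, piecewise-constant) derivatives of `Z¹, Z²`, one has
`∫₀^{2N} (Z²(u) − x₀)·(Z¹)'(u) du − ∫₀^{2N} (Z¹(u) − x₀)·(Z²)'(u) du
  = ∑_{k=0}^{N−1} (x_{k+1} − x_k)²`. -/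
theorem leadlag_levy_area_eq_quadratic_variation
    (N : ℕ) (hN : 1 ≤ N) (x : ℕ → ℝ) (Z1 Z2 D1 D2 : ℝ → ℝ)
    -- `Z` is affine on each interval `[m, m+1]`, `0 ≤ m < 2N` :
    (haff1 : ∀ m : ℕ, m < 2 * N → ∀ t ∈ Set.Icc (m : ℝ) ((m : ℝ) + 1),
      Z1 t = Z1 m + (t - m) * (Z1 (m + 1) - Z1 m))
    (haff2 : ∀ m : ℕ, m < 2 * N → ∀ t ∈ Set.Icc (m : ℝ) ((m : ℝ) + 1),
      Z2 t = Z2 m + (t - m) * (Z2 (m + 1) - Z2 m))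
    -- values at even integer times `2k`, `0 ≤ k ≤ N` :
    (heven : ∀ k : ℕ, k ≤ N → Z1 (2 * k) = x k ∧ Z2 (2 * k) = x k)
    -- values at odd integer times `2k+1`, `0 ≤ k ≤ N − 1` :
    (hodd : ∀ k : ℕ, k < N → Z1 (2 * k + 1) = x k ∧ Z2 (2 * k + 1) = x (k + 1))
    -- `D1, D2` are the derivatives of `Z1, Z2` away from the integer grid points :
    (hD : ∀ m : ℕ, m < 2 * N → ∀ t ∈ Set.Ioo (m : ℝ) ((m : ℝ) + 1),
      HasDerivAt Z1 (D1 t) t ∧ HasDerivAt Z2 (D2 t) t) :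
    (∫ u in (0 : ℝ)..(2 * N : ℕ), (Z2 u - x 0) * D1 u) -
      (∫ u in (0 : ℝ)..(2 * N : ℕ), (Z1 u - x 0) * D2 u) =
      ∑ k ∈ Finset.range N, (x (k + 1) - x k) ^ 2 := by
  rw [integral_sub_mul_deriv_eq_sum_of_piecewise_affine (2 * N) (x 0) haff2 haff1
      fun m hm t ht => (hD m hm t ht).1,
    integral_sub_mul_deriv_eq_sum_of_piecewise_affine (2 * N) (x 0) haff1 haff2
      fun m hm t ht => (hD m hm t ht).2,
    ← Finset.sum_sub_distrib, sum_range_two_mul_eq_sum_add]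
  refine Finset.sum_congr rfl fun k hk => ?_
  have hk : k < N := Finset.mem_range.mp hk
  obtain ⟨hZ1, hZ2⟩ := heven k hk.le
  obtain ⟨hZ1', hZ2'⟩ := hodd k hk
  obtain ⟨hZ1'', hZ2''⟩ := heven (k + 1) hk
  have hcast : (2 : ℝ) * k + 1 + 1 = 2 * ((k + 1 : ℕ) : ℝ) := by push_cast; ring
  simp only [Nat.cast_add, Nat.cast_mul, Nat.cast_ofNat, Nat.cast_one]
  rw [hcast, hZ1, hZ2, hZ1', hZ2', hZ1'', hZ2'']
  ring
end

section
/- Nonnegativity of the squared MMD for positive semidefinite kernels: let (S, 𝒮) be a measurable space and k : S × S → ℝ a bounded, measurable, symmetric kernel which is positive semidefinite, i.e. for every m ≥ 1, all points x₁, …, x_m ∈ S and all reals c₁, …, c_m one has ∑_{i,j} c_i c_j k(x_i, x_j) ≥ 0. Then for all probability measures μ, ν on S, MMD_k²(μ, ν) := ∬ k d(μ⊗μ) − 2 ∬ k d(μ⊗ν) + ∬ k d(ν⊗ν) ≥ 0. -/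
open MeasureTheory

theorem measurePreserving_eval_pair {T ι : Type*} [MeasurableSpace T] [Fintype ι] (ρ : Measure T)
    [IsProbabilityMeasure ρ] {i j : ι} (hij : i ≠ j) :
    MeasurePreserving (fun z : ι → T => (z i, z j)) (Measure.pi fun _ => ρ) (ρ.prod ρ) := by
  refine ⟨by fun_prop, ?_⟩
  have hind : ProbabilityTheory.iIndepFun (fun (i : ι) (z : ι → T) => z i)
      (Measure.pi fun _ => ρ) :=
    ProbabilityTheory.iIndepFun_pi (X := fun _ => id) fun _ => aemeasurable_id
  have hmap (l : ι) : (Measure.pi fun _ : ι => ρ).map (fun z => z l) = ρ :=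
    (measurePreserving_eval (fun _ => ρ) l).map_eq
  have h := (ProbabilityTheory.indepFun_iff_map_prod_eq_prod_map_map
    (measurable_pi_apply i).aemeasurable (measurable_pi_apply j).aemeasurable).1 (hind.indepFun hij)
  rwa [hmap, hmap] at h

/-- If all the sums `∑ i, ∑ j, h (z i) (z j)` of a bounded measurable kernel are nonnegative, then
so is its double integral against a probability measure. -/
theorem integral_prod_self_nonneg_of_sum_nonneg {T : Type*} [MeasurableSpace T] (h : T → T → ℝ)
    (h_meas : Measurable fun p : T × T => h p.1 p.2) {C : ℝ} (h_bdd : ∀ x y, |h x y| ≤ C)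
    (h_sum : ∀ (m : ℕ) (z : Fin m → T), 0 ≤ ∑ i, ∑ j, h (z i) (z j))
    (ρ : Measure T) [IsProbabilityMeasure ρ] :
    0 ≤ ∫ p : T × T, h p.1 p.2 ∂(ρ.prod ρ) := by
  set A := ∫ p : T × T, h p.1 p.2 ∂(ρ.prod ρ) with hA
  have key (m : ℕ) : 0 ≤ (m : ℝ) * (C + m * A - A) := by
    let P : Measure (Fin m → T) := Measure.pi fun _ => ρ
    have meas (i j : Fin m) : Measurable fun z : Fin m → T => h (z i) (z j) :=
      h_meas.comp (by fun_prop : Measurable fun z : Fin m → T => (z i, z j))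
    have int (i j : Fin m) : Integrable (fun z : Fin m → T => h (z i) (z j)) P :=
      .of_bound (meas i j).aestronglyMeasurable C (.of_forall fun z => h_bdd _ _)
    have off_diag (i j : Fin m) (hij : i ≠ j) : ∫ z, h (z i) (z j) ∂P = A := by
      have hp := measurePreserving_eval_pair ρ hij
      rw [hA, ← hp.map_eq, integral_map hp.measurable.aemeasurable
        h_meas.aestronglyMeasurable]
    have diag (i : Fin m) : ∫ z, h (z i) (z i) ∂P ≤ C := by
      simpa using integral_mono (int i i) (integrable_const C)
        fun z => (le_abs_self _).trans (h_bdd (z i) (z i))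
    calc
      0 ≤ ∫ z, ∑ i, ∑ j, h (z i) (z j) ∂P := integral_nonneg fun z => h_sum m z
      _ = ∑ i, ∑ j, ∫ z, h (z i) (z j) ∂P := by
        rw [integral_finsetSum _ fun i _ => integrable_finsetSum _ fun j _ => int i j]
        exact Finset.sum_congr rfl fun i _ => integral_finsetSum _ fun j _ => int i j
      _ ≤ ∑ i : Fin m, ∑ j : Fin m, (A + if i = j then C - A else 0) := by
        refine Finset.sum_le_sum fun i _ => Finset.sum_le_sum fun j _ => ?_
        split_ifs with hij
        · subst hij
          linarith [diag i]
        · rw [off_diag i j hij, add_zero]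
      _ = m * (C + m * A - A) := by
        simp only [Finset.sum_add_distrib, Finset.sum_const, Finset.card_univ, Fintype.card_fin,
          nsmul_eq_mul, Finset.sum_ite_eq, Finset.mem_univ, if_true]
        ring
  by_contra! hneg
  obtain ⟨n, hn⟩ := exists_nat_gt ((C - A) / -A)
  rw [div_lt_iff₀ (by linarith)] at hn
  have hn1 := key (n + 1)
  push_cast at hn1
  have := nonneg_of_mul_nonneg_right hn1 (by positivity)
  linarith

/-- The kernel on pairs obtained from a positive semidefinite kernel by taking differences in both
variables has nonnegative sums. -/
theorem sum_difference_kernel_nonneg {S : Type*} (k : S → S → ℝ)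
    (hk_psd : ∀ (m : ℕ) (x : Fin m → S) (c : Fin m → ℝ),
      0 ≤ ∑ i : Fin m, ∑ j : Fin m, c i * c j * k (x i) (x j))
    (m : ℕ) (z : Fin m → S × S) :
    0 ≤ ∑ i, ∑ j, (k (z i).1 (z j).1 - k (z i).1 (z j).2 - k (z i).2 (z j).1
      + k (z i).2 (z j).2) := by
  have h := hk_psd (m + m) (Fin.append (fun i => (z i).1) fun i => (z i).2)
    (Fin.append (fun _ => 1) fun _ => -1)
  simp only [Fin.sum_univ_add, Fin.append_left, Fin.append_right, Finset.sum_add_distrib,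
    mul_one, one_mul, mul_neg, neg_mul, Finset.sum_neg_distrib] at h
  simp only [Finset.sum_add_distrib, Finset.sum_sub_distrib]
  linarith

/-- **Nonnegativity of the squared MMD for positive semidefinite kernels.** Let `k` be a
bounded measurable symmetric kernel on a measurable space `S` which is positive
semidefinite, i.e. all finite Gram matrices `(k(x_i,x_j))` are positive semidefinite.
Then for all probability measures `μ, ν` on `S`,
`MMD_k²(μ,ν) = ∬ k d(μ⊗μ) − 2 ∬ k d(μ⊗ν) + ∬ k d(ν⊗ν) ≥ 0`. -/
theorem mmd_sq_nonneg_of_posSemidef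
    {S : Type*} [MeasurableSpace S] (k : S → S → ℝ)
    (hk_meas : Measurable fun p : S × S => k p.1 p.2)
    (hk_bdd : ∃ C : ℝ, ∀ x y, |k x y| ≤ C)
    (hk_symm : ∀ x y, k x y = k y x)
    (hk_psd : ∀ (m : ℕ) (x : Fin m → S) (c : Fin m → ℝ),
      0 ≤ ∑ i : Fin m, ∑ j : Fin m, c i * c j * k (x i) (x j))
    (μ ν : Measure S) [IsProbabilityMeasure μ] [IsProbabilityMeasure ν] :
    0 ≤ (∫ p : S × S, k p.1 p.2 ∂(μ.prod μ)) -
        2 * (∫ p : S × S, k p.1 p.2 ∂(μ.prod ν)) +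
        (∫ p : S × S, k p.1 p.2 ∂(ν.prod ν)) := by
  obtain ⟨C, hC⟩ := hk_bdd
  let ρ := (μ.prod ν).prod (μ.prod ν)
  have integrable_comp (f : (S × S) × (S × S) → S × S) (hf : Measurable f) :
      Integrable (fun p => k (f p).1 (f p).2) ρ :=
    .of_bound (hk_meas.comp hf).aestronglyMeasurable C (.of_forall fun p => hC _ _)
  have integral_comp (f g : S × S → S) (α β : Measure S) (hf : MeasurePreserving f (μ.prod ν) α)
      (hg : MeasurePreserving g (μ.prod ν) β) [IsProbabilityMeasure α] [IsProbabilityMeasure β] :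
      ∫ p, k (f p.1) (g p.2) ∂ρ = ∫ p : S × S, k p.1 p.2 ∂(α.prod β) := by
    have hfg := hf.prod hg
    rw [← hfg.map_eq, integral_map hfg.measurable.aemeasurable hk_meas.aestronglyMeasurable]
    rfl
  have hfst : MeasurePreserving Prod.fst (μ.prod ν) μ := measurePreserving_fst
  have hsnd : MeasurePreserving Prod.snd (μ.prod ν) ν := measurePreserving_snd
  have hswap : ∫ p : S × S, k p.1 p.2 ∂(ν.prod μ) = ∫ p : S × S, k p.1 p.2 ∂(μ.prod ν) := by
    rw [← integral_prod_swap]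
    exact integral_congr_ae (.of_forall fun p => hk_symm _ _)
  have h11 : Integrable (fun p : (S × S) × (S × S) => k p.1.1 p.2.1) ρ :=
    integrable_comp (fun p => (p.1.1, p.2.1)) (by fun_prop)
  have h12 : Integrable (fun p : (S × S) × (S × S) => k p.1.1 p.2.2) ρ :=
    integrable_comp (fun p => (p.1.1, p.2.2)) (by fun_prop)
  have h21 : Integrable (fun p : (S × S) × (S × S) => k p.1.2 p.2.1) ρ :=
    integrable_comp (fun p => (p.1.2, p.2.1)) (by fun_prop)
  have h22 : Integrable (fun p : (S × S) × (S × S) => k p.1.2 p.2.2) ρ :=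
    integrable_comp (fun p => (p.1.2, p.2.2)) (by fun_prop)
  have hsub : Integrable (fun p : (S × S) × (S × S) => k p.1.1 p.2.1 - k p.1.1 p.2.2) ρ :=
    h11.sub h12
  have hsub' : Integrable
      (fun p : (S × S) × (S × S) => k p.1.1 p.2.1 - k p.1.1 p.2.2 - k p.1.2 p.2.1) ρ :=
    hsub.sub h21
  have meas_comp (f : (S × S) × (S × S) → S × S) (hf : Measurable f) :
      Measurable fun p => k (f p).1 (f p).2 := hk_meas.comp hf
  have h := integral_prod_self_nonneg_of_sum_nonneg
    (fun z w : S × S => k z.1 w.1 - k z.1 w.2 - k z.2 w.1 + k z.2 w.2)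
    ((((meas_comp (fun p => (p.1.1, p.2.1)) (by fun_prop)).sub
      (meas_comp (fun p => (p.1.1, p.2.2)) (by fun_prop))).sub
      (meas_comp (fun p => (p.1.2, p.2.1)) (by fun_prop))).add
      (meas_comp (fun p => (p.1.2, p.2.2)) (by fun_prop)))
    (C := C + C + C + C)
    (fun z w => (abs_add_le _ _).trans <| add_le_add ((abs_sub _ _).trans <|
      add_le_add ((abs_sub _ _).trans <| add_le_add (hC _ _) (hC _ _)) (hC _ _)) (hC _ _))
    (sum_difference_kernel_nonneg k hk_psd) (μ.prod ν)
  rw [integral_add hsub' h22, integral_sub hsub h21,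
    integral_sub h11 h12, integral_comp _ _ _ _ hfst hfst, integral_comp _ _ _ _ hfst hsnd,
    integral_comp _ _ _ _ hsnd hfst, integral_comp _ _ _ _ hsnd hsnd, hswap] at h
  linarith
end
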